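/- For parameters λ, μ, γ ∈ K* and i ∈ ℤ, the assignment X ↦ λK^iX, Y ↦ μK^{-i}Y, K ↦ γK, E ↦ λμ^{-1}q^{-2i}K^{2i}E extends to a K-algebra automorphism σ_{λ,μ,γ,i} of the quantum spatial ageing algebra A. -/

import Mathlib

/-- Generators of the quantum spatial ageing algebra. -/
inductive QGen : Type
  | E | K | Kinv | X | Y

open FreeAlgebra in
/-- Defining relations of the quantum spatial ageing algebra
`EK = q⁻²KE`, `XK = q⁻¹KX`, `YK = qKY`, `EX = qXE`, `EY = X + q⁻¹YE`, `qYX = XY`,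
together with `K K⁻¹ = K⁻¹ K = 1`. -/
inductive QSARel (k : Type) [Field k] (q : k) :
    FreeAlgebra k QGen → FreeAlgebra k QGen → Prop
  | KKinv : QSARel k q (ι k QGen.K * ι k QGen.Kinv) 1
  | KinvK : QSARel k q (ι k QGen.Kinv * ι k QGen.K) 1
  | EK : QSARel k q (ι k QGen.E * ι k QGen.K) ((q ^ 2)⁻¹ • (ι k QGen.K * ι k QGen.E))
  | XK : QSARel k q (ι k QGen.X * ι k QGen.K) (q⁻¹ • (ι k QGen.K * ι k QGen.X))
  | YK : QSARel k q (ι k QGen.Y * ι k QGen.K) (q • (ι k QGen.K * ι k QGen.Y))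
  | EX : QSARel k q (ι k QGen.E * ι k QGen.X) (q • (ι k QGen.X * ι k QGen.E))
  | EY : QSARel k q (ι k QGen.E * ι k QGen.Y)
      (ι k QGen.X + q⁻¹ • (ι k QGen.Y * ι k QGen.E))
  | YX : QSARel k q (q • (ι k QGen.Y * ι k QGen.X)) (ι k QGen.X * ι k QGen.Y)

/-- The quantum spatial ageing algebra `𝒜 = 𝕂_q[X,Y] ⋊ U_q^{≥0}(sl₂)`. -/
noncomputable abbrev QSA (k : Type) [Field k] (q : k) : Type := RingQuot (QSARel k q)

noncomputable def Egen (k : Type) [Field k] (q : k) : QSA k q :=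
  RingQuot.mkAlgHom k (QSARel k q) (FreeAlgebra.ι k QGen.E)
noncomputable def Kgen (k : Type) [Field k] (q : k) : QSA k q :=
  RingQuot.mkAlgHom k (QSARel k q) (FreeAlgebra.ι k QGen.K)
noncomputable def Kinvgen (k : Type) [Field k] (q : k) : QSA k q :=
  RingQuot.mkAlgHom k (QSARel k q) (FreeAlgebra.ι k QGen.Kinv)
noncomputable def Xgen (k : Type) [Field k] (q : k) : QSA k q :=
  RingQuot.mkAlgHom k (QSARel k q) (FreeAlgebra.ι k QGen.X)
noncomputable def Ygen (k : Type) [Field k] (q : k) : QSA k q :=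
  RingQuot.mkAlgHom k (QSARel k q) (FreeAlgebra.ι k QGen.Y)

/-- The normal element `φ = EY - qYE`. -/
noncomputable def phi (k : Type) [Field k] (q : k) : QSA k q :=
  Egen k q * Ygen k q - q • (Ygen k q * Egen k q)

/-- `K` as a unit of `𝒜` (with inverse `K⁻¹`). -/
noncomputable def Kunit (k : Type) [Field k] (q : k) : (QSA k q)ˣ where
  val := Kgen k q
  inv := Kinvgen k q
  val_inv := by
    rw [Kgen, Kinvgen, ← map_mul, RingQuot.mkAlgHom_rel k QSARel.KKinv, map_one]
  inv_val := by
    rw [Kinvgen, Kgen, ← map_mul, RingQuot.mkAlgHom_rel k QSARel.KinvK, map_one]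

section Scalars

variable {k A : Type*} [Field k] [Ring A] [Algebra k A]

theorem coe_zpow_of_coe_eq_smul {u v : Aˣ} {c : k} (hc : c ≠ 0)
    (h : (v : A) = c • (u : A)) (n : ℤ) :
    ((v ^ n : Aˣ) : A) = c ^ n • ((u ^ n : Aˣ) : A) := by
  set C : Aˣ := Units.map (algebraMap k A : k →* A) (Units.mk0 c hc) with hC
  have hv : v = C * u := Units.ext (by simp [hC, h, Algebra.smul_def])
  have hcomm : Commute C u := Units.ext (by simpa [hC] using Algebra.commutes c (u : A))
  rw [hv, hcomm.mul_zpow, Units.val_mul, hC, ← map_zpow, Algebra.smul_def]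
  simp only [Units.coe_map, MonoidHom.coe_coe, Units.val_zpow_eq_zpow_val, Units.val_mk0]

theorem mul_coe_zpow_of_mul_eq_smul {u : Aˣ} {a : A} {c : k} (hc : c ≠ 0)
    (h : a * u = c • ((u : A) * a)) (n : ℤ) :
    a * ((u ^ n : Aˣ) : A) = c ^ n • (((u ^ n : Aˣ) : A) * a) := by
  obtain ⟨v, hv⟩ : ∃ v : Aˣ, (v : A) = c • (u : A) :=
    ⟨Units.map (algebraMap k A : k →* A) (Units.mk0 c hc) * u, by simp [Algebra.smul_def]⟩
  have hs : SemiconjBy a (u : A) (v : A) := by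
    rw [SemiconjBy, h, hv, smul_mul_assoc]
  rw [(hs.units_zpow_right n).eq, coe_zpow_of_coe_eq_smul hc hv, smul_mul_assoc]

end Scalars

namespace QSA

variable {k : Type} [Field k] {q : k}

theorem Egen_mul_Kgen : Egen k q * Kgen k q = (q ^ 2)⁻¹ • (Kgen k q * Egen k q) := by
  simpa [Egen, Kgen] using RingQuot.mkAlgHom_rel k (QSARel.EK (q := q))

theorem Xgen_mul_Kgen : Xgen k q * Kgen k q = q⁻¹ • (Kgen k q * Xgen k q) := by
  simpa [Xgen, Kgen] using RingQuot.mkAlgHom_rel k (QSARel.XK (q := q))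

theorem Ygen_mul_Kgen : Ygen k q * Kgen k q = q • (Kgen k q * Ygen k q) := by
  simpa [Ygen, Kgen] using RingQuot.mkAlgHom_rel k (QSARel.YK (q := q))

theorem Egen_mul_Xgen : Egen k q * Xgen k q = q • (Xgen k q * Egen k q) := by
  simpa [Egen, Xgen] using RingQuot.mkAlgHom_rel k (QSARel.EX (q := q))

theorem Egen_mul_Ygen :
    Egen k q * Ygen k q = Xgen k q + q⁻¹ • (Ygen k q * Egen k q) := by
  simpa [Egen, Xgen, Ygen] using RingQuot.mkAlgHom_rel k (QSARel.EY (q := q))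

theorem smul_Ygen_mul_Xgen : q • (Ygen k q * Xgen k q) = Xgen k q * Ygen k q := by
  simpa [Xgen, Ygen] using RingQuot.mkAlgHom_rel k (QSARel.YX (q := q))

/-- Powers of `K`, as elements of the algebra. -/
noncomputable def Kpow (k : Type) [Field k] (q : k) (n : ℤ) : QSA k q :=
  ((Kunit k q ^ n : (QSA k q)ˣ) : QSA k q)

theorem Kpow_zero : Kpow k q 0 = 1 := by simp [Kpow]

theorem Kpow_one : Kpow k q 1 = Kgen k q := by simp [Kpow, Kunit]

theorem Kpow_neg_one : Kpow k q (-1) = Kinvgen k q := by simp [Kpow, Kunit]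

theorem Kpow_mul_Kpow (m n : ℤ) : Kpow k q m * Kpow k q n = Kpow k q (m + n) := by
  simp [Kpow, zpow_add]

theorem Kpow_mul_Kpow_mul (m n : ℤ) (a : QSA k q) :
    Kpow k q m * (Kpow k q n * a) = Kpow k q (m + n) * a := by
  rw [← mul_assoc, Kpow_mul_Kpow]

theorem Xgen_mul_Kpow (hq : q ≠ 0) (n : ℤ) :
    Xgen k q * Kpow k q n = q ^ (-n) • (Kpow k q n * Xgen k q) := by
  have h := mul_coe_zpow_of_mul_eq_smul (u := Kunit k q) (inv_ne_zero hq) Xgen_mul_Kgen n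
  rwa [inv_zpow'] at h

theorem Ygen_mul_Kpow (hq : q ≠ 0) (n : ℤ) :
    Ygen k q * Kpow k q n = q ^ n • (Kpow k q n * Ygen k q) :=
  mul_coe_zpow_of_mul_eq_smul (u := Kunit k q) hq Ygen_mul_Kgen n

theorem Egen_mul_Kpow (hq : q ≠ 0) (n : ℤ) :
    Egen k q * Kpow k q n = q ^ (-2 * n) • (Kpow k q n * Egen k q) := by
  have h := mul_coe_zpow_of_mul_eq_smul (u := Kunit k q)
    (inv_ne_zero (pow_ne_zero 2 hq)) Egen_mul_Kgen n
  rwa [← zpow_natCast, ← zpow_neg, ← zpow_mul] at h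

/-- Move the middle power of `K` in `(Kᵐ a) (Kⁿ b)` to the left. -/
theorem Kpow_mul_mul_Kpow_mul {a : QSA k q} {c : k} {n : ℤ}
    (h : a * Kpow k q n = c • (Kpow k q n * a)) (m : ℤ) (b : QSA k q) :
    Kpow k q m * a * (Kpow k q n * b) = c • (Kpow k q (m + n) * (a * b)) := by
  rw [mul_assoc, ← mul_assoc a, h, smul_mul_assoc, mul_smul_comm, mul_assoc,
    Kpow_mul_Kpow_mul]

theorem algHom_ext {B : Type*} [Semiring B] [Algebra k B] {f g : QSA k q →ₐ[k] B}
    (hE : f (Egen k q) = g (Egen k q)) (hK : f (Kgen k q) = g (Kgen k q))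
    (hKinv : f (Kinvgen k q) = g (Kinvgen k q))
    (hX : f (Xgen k q) = g (Xgen k q)) (hY : f (Ygen k q) = g (Ygen k q)) : f = g := by
  refine RingQuot.ringQuot_ext' k _ _ (FreeAlgebra.hom_ext (funext fun a => ?_))
  cases a
  exacts [hE, hK, hKinv, hX, hY]

/-- The images of the generators under `σ_{λ,μ,γ,i}`. -/
noncomputable def sigmaGen (q lam mu gam : k) (i : ℤ) : QGen → QSA k q
  | .E => (lam * mu⁻¹ * q ^ (-2 * i)) • (Kpow k q (2 * i) * Egen k q)
  | .K => gam • Kpow k q 1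
  | .Kinv => gam⁻¹ • Kpow k q (-1)
  | .X => lam • (Kpow k q i * Xgen k q)
  | .Y => mu • (Kpow k q (-i) * Ygen k q)

theorem lift_sigmaGen_rel (hq : q ≠ 0) {lam mu gam : k} (hmu : mu ≠ 0)
    (hgam : gam ≠ 0) (i : ℤ) ⦃a b : FreeAlgebra k QGen⦄ (h : QSARel k q a b) :
    FreeAlgebra.lift k (sigmaGen q lam mu gam i) a =
      FreeAlgebra.lift k (sigmaGen q lam mu gam i) b := by
  have hz (n : ℤ) : q ^ n ≠ 0 := zpow_ne_zero n hq
  cases h with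
  | KKinv => simp [sigmaGen, Kpow_mul_Kpow, Kpow_zero, smul_smul, hgam]
  | KinvK => simp [sigmaGen, Kpow_mul_Kpow, Kpow_zero, smul_smul, hgam]
  | EK =>
    simp only [map_mul, map_smul, FreeAlgebra.lift_ι_apply, sigmaGen, smul_mul_assoc,
      mul_smul_comm, smul_smul, mul_assoc, Egen_mul_Kpow hq, Kpow_mul_Kpow_mul]
    rw [add_comm]
    congr 1
    rw [show (-2 : ℤ) * 1 = -(2 : ℕ) by norm_num, zpow_neg, zpow_natCast]
    ring
  | XK =>
    simp only [map_mul, map_smul, FreeAlgebra.lift_ι_apply, sigmaGen, smul_mul_assoc,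
      mul_smul_comm, smul_smul, mul_assoc, Xgen_mul_Kpow hq, Kpow_mul_Kpow_mul]
    rw [add_comm]
    congr 1
    rw [zpow_neg_one]
    ring
  | YK =>
    simp only [map_mul, map_smul, FreeAlgebra.lift_ι_apply, sigmaGen, smul_mul_assoc,
      mul_smul_comm, smul_smul, mul_assoc, Ygen_mul_Kpow hq, Kpow_mul_Kpow_mul]
    rw [add_comm]
    congr 1
    rw [zpow_one]
    ring
  | EX =>
    simp only [map_mul, map_smul, FreeAlgebra.lift_ι_apply, sigmaGen, smul_mul_assoc,
      mul_smul_comm, smul_smul, Kpow_mul_mul_Kpow_mul (Egen_mul_Kpow hq _),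
      Kpow_mul_mul_Kpow_mul (Xgen_mul_Kpow hq _), Egen_mul_Xgen]
    rw [add_comm, neg_mul]
    congr 1
    ring
  | EY =>
    simp only [map_mul, map_add, map_smul, FreeAlgebra.lift_ι_apply, sigmaGen,
      smul_mul_assoc, mul_smul_comm, smul_smul, Kpow_mul_mul_Kpow_mul (Egen_mul_Kpow hq _),
      Kpow_mul_mul_Kpow_mul (Ygen_mul_Kpow hq _), Egen_mul_Ygen, mul_add, smul_add]
    have hmul : q ^ (-2 * i) * q ^ (2 * i) = 1 := by
      rw [← zpow_add₀ hq]; simp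
    have hdiv : mu * mu⁻¹ = 1 := mul_inv_cancel₀ hmu
    rw [show 2 * i + -i = i by ring, show -i + 2 * i = i by ring,
      show -2 * -i = 2 * i by ring]
    congr 2
    · linear_combination lam * mu * mu⁻¹ * hmul + lam * hdiv
    · ring
  | YX =>
    simp only [map_mul, map_smul, FreeAlgebra.lift_ι_apply, sigmaGen, smul_mul_assoc,
      mul_smul_comm, smul_smul, Kpow_mul_mul_Kpow_mul (Xgen_mul_Kpow hq _),
      Kpow_mul_mul_Kpow_mul (Ygen_mul_Kpow hq _), ← smul_Ygen_mul_Xgen]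
    rw [neg_neg, add_comm]
    congr 1
    ring

/-- The endomorphism `σ_{λ,μ,γ,i}`. -/
noncomputable def sigma (hq : q ≠ 0) (lam : k) {mu gam : k} (hmu : mu ≠ 0)
    (hgam : gam ≠ 0) (i : ℤ) : QSA k q →ₐ[k] QSA k q :=
  RingQuot.liftAlgHom k
    ⟨FreeAlgebra.lift k (sigmaGen q lam mu gam i), lift_sigmaGen_rel hq hmu hgam i⟩

section sigma

variable (hq : q ≠ 0) (lam : k) {mu gam : k} (hmu : mu ≠ 0) (hgam : gam ≠ 0) (i : ℤ)

theorem sigma_Egen : sigma hq lam hmu hgam i (Egen k q) =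
    (lam * mu⁻¹ * q ^ (-2 * i)) • (Kpow k q (2 * i) * Egen k q) := by
  simp [sigma, Egen, sigmaGen]

theorem sigma_Kgen : sigma hq lam hmu hgam i (Kgen k q) = gam • Kgen k q := by
  rw [← Kpow_one (q := q)]
  nth_rewrite 1 [Kpow_one]
  simp [sigma, Kgen, sigmaGen]

theorem sigma_Xgen :
    sigma hq lam hmu hgam i (Xgen k q) = lam • (Kpow k q i * Xgen k q) := by
  simp [sigma, Xgen, sigmaGen]

theorem sigma_Ygen :
    sigma hq lam hmu hgam i (Ygen k q) = mu • (Kpow k q (-i) * Ygen k q) := by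
  simp [sigma, Ygen, sigmaGen]

theorem sigma_Kpow (n : ℤ) :
    sigma hq lam hmu hgam i (Kpow k q n) = gam ^ n • Kpow k q n := by
  have h := coe_zpow_of_coe_eq_smul (u := Kunit k q)
    (v := Units.map (sigma hq lam hmu hgam i : QSA k q →* QSA k q) (Kunit k q)) hgam
    (sigma_Kgen hq lam hmu hgam i) n
  rwa [← map_zpow] at h

theorem sigma_comp_sigma {lam' mu' gam' : k} (hmu' : mu' ≠ 0) (hgam' : gam' ≠ 0) {j : ℤ}
    (hj : j = -i) (hg : gam * gam' = 1) (hl : lam * gam' ^ i * lam' = 1)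
    (hm : mu * gam' ^ (-i) * mu' = 1) :
    (sigma hq lam' hmu' hgam' j).comp (sigma hq lam hmu hgam i) =
      AlgHom.id k (QSA k q) := by
  subst hj
  have hzero : ∀ n : ℤ, n + -n = 0 := add_neg_cancel
  apply algHom_ext
  · rw [AlgHom.comp_apply, sigma_Egen, map_smul, map_mul, sigma_Kpow, sigma_Egen,
      smul_mul_assoc, mul_smul_comm, Kpow_mul_Kpow_mul, smul_smul, smul_smul,
      show 2 * i + 2 * -i = 0 by ring, Kpow_zero, one_mul, AlgHom.id_apply]
    have hgz : gam' ^ (2 * i) = gam' ^ i * (gam' ^ (-i))⁻¹ := by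
      rw [← zpow_neg, ← zpow_add₀ hgam']; congr 1; ring
    have hqz : q ^ (-2 * i) * q ^ (-2 * -i) = 1 := by
      rw [← zpow_add₀ hq]; simp
    have hm' : mu⁻¹ * (gam' ^ (-i))⁻¹ * mu'⁻¹ = 1 := by
      rw [← mul_inv, ← mul_inv, hm, inv_one]
    convert one_smul k (Egen k q) using 2
    rw [hgz]
    calc _ = (lam * gam' ^ i * lam') * (mu⁻¹ * (gam' ^ (-i))⁻¹ * mu'⁻¹) *
          (q ^ (-2 * i) * q ^ (-2 * -i)) := by ring
      _ = 1 := by rw [hl, hm', hqz]; ring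
  · rw [AlgHom.comp_apply, sigma_Kgen, map_smul, sigma_Kgen, smul_smul, hg, one_smul,
      AlgHom.id_apply]
  · rw [← Kpow_neg_one, AlgHom.comp_apply, sigma_Kpow, map_smul, sigma_Kpow, smul_smul,
      ← mul_zpow, hg, one_zpow, one_smul, AlgHom.id_apply]
  · rw [AlgHom.comp_apply, sigma_Xgen, map_smul, map_mul, sigma_Kpow, sigma_Xgen,
      smul_mul_assoc, mul_smul_comm, Kpow_mul_Kpow_mul, smul_smul, smul_smul, hl,
      hzero, Kpow_zero, one_mul, one_smul, AlgHom.id_apply]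
  · rw [AlgHom.comp_apply, sigma_Ygen, map_smul, map_mul, sigma_Kpow, sigma_Ygen,
      smul_mul_assoc, mul_smul_comm, Kpow_mul_Kpow_mul, smul_smul, smul_smul, hm,
      hzero, Kpow_zero, one_mul, one_smul, AlgHom.id_apply]

end sigma

end QSA

/-- for `λ, μ, γ ∈ 𝕂*` and `i ∈ ℤ` the assignment
`X ↦ λKⁱX`, `Y ↦ μK⁻ⁱY`, `K ↦ γK`, `E ↦ λμ⁻¹q⁻²ⁱK²ⁱE` extends to a
`𝕂`-algebra automorphism of `𝒜`. -/
theorem stmt15 (k : Type) [Field k] (q : k) (hq : q ≠ 0)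
    (hq' : ∀ n : ℕ, n ≠ 0 → q ^ n ≠ 1)
    (lam mu gam : k) (hlam : lam ≠ 0) (hmu : mu ≠ 0) (hgam : gam ≠ 0) (i : ℤ) :
    ∃ σ : QSA k q ≃ₐ[k] QSA k q,
      σ (Xgen k q) = lam • (((Kunit k q ^ i : (QSA k q)ˣ) : QSA k q) * Xgen k q) ∧
      σ (Ygen k q) = mu • (((Kunit k q ^ (-i) : (QSA k q)ˣ) : QSA k q) * Ygen k q) ∧
      σ (Kgen k q) = gam • Kgen k q ∧
      σ (Egen k q) =
        (lam * mu⁻¹ * q ^ (-2 * i)) •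
          (((Kunit k q ^ (2 * i) : (QSA k q)ˣ) : QSA k q) * Egen k q) := by
  have hgi (n : ℤ) : gam ^ n ≠ 0 := zpow_ne_zero n hgam
  have hmu' : mu⁻¹ * gam ^ (-i) ≠ 0 := mul_ne_zero (inv_ne_zero hmu) (hgi _)
  refine ⟨AlgEquiv.ofAlgHom (QSA.sigma hq lam hmu hgam i)
    (QSA.sigma hq (lam⁻¹ * gam ^ i) hmu' (inv_ne_zero hgam) (-i)) ?_ ?_,
    QSA.sigma_Xgen .., QSA.sigma_Ygen .., QSA.sigma_Kgen .., QSA.sigma_Egen ..⟩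
  all_goals
    apply QSA.sigma_comp_sigma
    all_goals have := hgi i
    all_goals try simp only [neg_neg, inv_zpow', zpow_neg]
    all_goals try field_simp
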